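/- A biquadratic polynomial h(x,y) with complex coefficients satisfies δ_y(h) = 0 and δ_x(h) = 0 (as polynomials) if and only if there exist κ, λ, μ, ν ∈ ℂ such that h(x,y) = (κxy + λx + μy + ν)²; in that case i₂(h) = 12(κν − λμ)² and i₃(h) = 2(κν − λμ)³. -/

import Mathlib

open MvPolynomial

/-- `δ_{x_i}(h) = h_{x_i}^2 - 2 h h_{x_i x_i}` for a polynomial of two variables
(`x` is the variable indexed `0`, `y` the one indexed `1`). -/
noncomputable def ds (i : Fin 2) (h : MvPolynomial (Fin 2) ℂ) : MvPolynomial (Fin 2) ℂ :=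
  (pderiv i h) ^ 2 - 2 * h * pderiv i (pderiv i h)

/-- The coefficient of `x^i y^j` in `h(x,y)`. -/
noncomputable def cf (h : MvPolynomial (Fin 2) ℂ) (i j : ℕ) : ℂ :=
  h.coeff (Finsupp.single (0 : Fin 2) i + Finsupp.single (1 : Fin 2) j)

/-- `i₂(h) = 8 h₀₀ h₂₂ - 4 h₀₁ h₂₁ - 4 h₁₀ h₁₂ + 8 h₀₂ h₂₀ + h₁₁²`. -/
noncomputable def inv2 (h : MvPolynomial (Fin 2) ℂ) : ℂ :=
  8 * cf h 0 0 * cf h 2 2 - 4 * cf h 0 1 * cf h 2 1 - 4 * cf h 1 0 * cf h 1 2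
    + 8 * cf h 0 2 * cf h 2 0 + (cf h 1 1) ^ 2

/-- `i₃(h) = det [[h₂₂, h₂₁, h₂₀], [h₁₂, h₁₁, h₁₀], [h₀₂, h₀₁, h₀₀]]`. -/
noncomputable def inv3 (h : MvPolynomial (Fin 2) ℂ) : ℂ :=
  Matrix.det !![cf h 2 2, cf h 2 1, cf h 2 0;
                cf h 1 2, cf h 1 1, cf h 1 0;
                cf h 0 2, cf h 0 1, cf h 0 0]

/-- The exponents `x^i y^j` determine `i` and `j`. -/
theorem single_add_single_inj {i j k l : ℕ} :
    Finsupp.single (0 : Fin 2) i + Finsupp.single (1 : Fin 2) j =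
      Finsupp.single (0 : Fin 2) k + Finsupp.single (1 : Fin 2) l ↔ i = k ∧ j = l := by
  constructor
  · intro h
    have h0 := DFunLike.congr_fun h 0
    have h1 := DFunLike.congr_fun h 1
    simpa using And.intro h0 h1
  · rintro ⟨rfl, rfl⟩
    rfl

theorem monomial_single_add_single (i j : ℕ) (a : ℂ) :
    monomial (Finsupp.single (0 : Fin 2) i + Finsupp.single (1 : Fin 2) j) a =
      C a * X 0 ^ i * X 1 ^ j := by
  rw [X_pow_eq_monomial, X_pow_eq_monomial, C_mul_monomial, monomial_mul]
  simp

theorem cf_sum_range (a : ℕ → ℕ → ℂ) {i j : ℕ} (hi : i < 3) (hj : j < 3) :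
    cf (∑ k ∈ Finset.range 3, ∑ l ∈ Finset.range 3, C (a k l) * X 0 ^ k * X 1 ^ l) i j =
      a i j := by
  simp only [cf, ← monomial_single_add_single, coeff_sum, coeff_monomial, single_add_single_inj]
  rw [Finset.sum_eq_single i, Finset.sum_eq_single j] <;> simp +contextual [hi, hj]

/-- A biquadratic polynomial is the sum of its nine terms. -/
theorem eq_sum_range_cf {h : MvPolynomial (Fin 2) ℂ} (hh : ∀ i, h.degreeOf i ≤ 2) :
    h = ∑ k ∈ Finset.range 3, ∑ l ∈ Finset.range 3, C (cf h k l) * X 0 ^ k * X 1 ^ l := by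
  ext m
  have hm : m = Finsupp.single 0 (m 0) + Finsupp.single 1 (m 1) := by
    ext i
    fin_cases i <;> simp
  by_cases hb : m 0 < 3 ∧ m 1 < 3
  · have := cf_sum_range (cf h) hb.1 hb.2
    rw [cf, cf, ← hm] at this
    exact this.symm
  · have h0 : coeff m h = 0 := by
      by_contra hne
      have hs := mem_support_iff.mpr hne
      have h0 := (monomial_le_degreeOf 0 hs).trans (hh 0)
      have h1 := (monomial_le_degreeOf 1 hs).trans (hh 1)
      omega
    rw [h0, hm]
    simp only [← monomial_single_add_single, coeff_sum, coeff_monomial, single_add_single_inj]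
    symm
    refine Finset.sum_eq_zero fun k hk => Finset.sum_eq_zero fun l hl => if_neg ?_
    rw [Finset.mem_range] at hk hl
    omega

/-- A complex polynomial function of degree at most four that vanishes everywhere has zero
coefficients. -/
theorem quartic_coeffs_eq_zero {a b c d e : ℂ}
    (h : ∀ x : ℂ, a + b * x + c * x ^ 2 + d * x ^ 3 + e * x ^ 4 = 0) :
    a = 0 ∧ b = 0 ∧ c = 0 ∧ d = 0 ∧ e = 0 := by
  have h0 := h 0
  have h1 := h 1
  have h2 := h (-1)
  have h3 := h 2
  have h4 := h (-2)
  refine ⟨?_, ?_, ?_, ?_, ?_⟩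
  · linear_combination h0
  · linear_combination (2 / 3) * h1 - (2 / 3) * h2 - (1 / 12) * h3 + (1 / 12) * h4
  · linear_combination -(5 / 4) * h0 + (2 / 3) * h1 + (2 / 3) * h2 - (1 / 24) * h3 - (1 / 24) * h4
  · linear_combination -(1 / 6) * h1 + (1 / 6) * h2 + (1 / 12) * h3 - (1 / 12) * h4
  · linear_combination (1 / 4) * h0 - (1 / 6) * h1 - (1 / 6) * h2 + (1 / 24) * h3 + (1 / 24) * h4

theorem exists_eq_sq (z : ℂ) : ∃ w, z = w ^ 2 :=
  (IsAlgClosed.exists_pow_nat_eq z two_pos).imp fun _ h => h.symm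

/-- If both discriminants of a `3 × 3` coefficient array vanish, then the array consists of the
coefficients of the square of a bilinear polynomial. -/
theorem exists_sqrt_coeffs (a : ℕ → ℕ → ℂ)
    (hy : ∀ x : ℂ, (a 0 1 + a 1 1 * x + a 2 1 * x ^ 2) ^ 2 -
      4 * (a 0 2 + a 1 2 * x + a 2 2 * x ^ 2) * (a 0 0 + a 1 0 * x + a 2 0 * x ^ 2) = 0)
    (hx : ∀ y : ℂ, (a 1 0 + a 1 1 * y + a 1 2 * y ^ 2) ^ 2 -
      4 * (a 2 0 + a 2 1 * y + a 2 2 * y ^ 2) * (a 0 0 + a 0 1 * y + a 0 2 * y ^ 2) = 0) :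
    ∃ k l m n : ℂ, a 2 2 = k ^ 2 ∧ a 2 1 = 2 * k * l ∧ a 2 0 = l ^ 2 ∧ a 1 2 = 2 * k * m ∧
      a 1 1 = 2 * k * n + 2 * l * m ∧ a 1 0 = 2 * l * n ∧ a 0 2 = m ^ 2 ∧
      a 0 1 = 2 * m * n ∧ a 0 0 = n ^ 2 := by
  generalize a 0 0 = a00 at *
  generalize a 0 1 = a01 at *
  generalize a 0 2 = a02 at *
  generalize a 1 0 = a10 at *
  generalize a 1 1 = a11 at *
  generalize a 1 2 = a12 at *
  generalize a 2 0 = a20 at *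
  generalize a 2 1 = a21 at *
  generalize a 2 2 = a22 at *
  obtain ⟨p0, p1, p2, p3, p4⟩ := quartic_coeffs_eq_zero (a := a01 ^ 2 - 4 * a02 * a00)
    (b := 2 * a01 * a11 - 4 * (a02 * a10 + a12 * a00))
    (c := a11 ^ 2 + 2 * a01 * a21 - 4 * (a02 * a20 + a12 * a10 + a22 * a00))
    (d := 2 * a11 * a21 - 4 * (a22 * a10 + a12 * a20)) (e := a21 ^ 2 - 4 * a22 * a20)
    (fun x => by linear_combination hy x)
  obtain ⟨q0, q1, q2, q3, q4⟩ := quartic_coeffs_eq_zero (a := a10 ^ 2 - 4 * a20 * a00)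
    (b := 2 * a10 * a11 - 4 * (a20 * a01 + a21 * a00))
    (c := a11 ^ 2 + 2 * a10 * a12 - 4 * (a20 * a02 + a21 * a01 + a22 * a00))
    (d := 2 * a11 * a12 - 4 * (a22 * a01 + a21 * a02)) (e := a12 ^ 2 - 4 * a22 * a02)
    (fun y => by linear_combination hx y)
  clear hx hy
  by_cases h22 : a22 = 0
  · subst h22
    obtain rfl : a21 = 0 := by simpa using p4
    obtain rfl : a12 = 0 := by simpa using q4
    by_cases h20 : a20 = 0
    · subst h20
      obtain rfl : a11 = 0 := by simpa using p2
      obtain rfl : a10 = 0 := by simpa using q0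
      by_cases h02 : a02 = 0
      · subst h02
        obtain rfl : a01 = 0 := by simpa using p0
        obtain ⟨n, rfl⟩ := exists_eq_sq a00
        exact ⟨0, 0, 0, n, by simp⟩
      · obtain ⟨m, rfl⟩ := exists_eq_sq a02
        have hm : m ≠ 0 := by rintro rfl; simp at h02
        obtain ⟨n, rfl⟩ : ∃ n, a01 = 2 * m * n := ⟨a01 / (2 * m), by field_simp⟩
        refine ⟨0, 0, m, n, by simp, by simp, by simp, by simp, by simp, by simp, rfl, rfl, ?_⟩
        apply mul_left_cancel₀ h02
        linear_combination -p0 / 4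
    · obtain ⟨l, rfl⟩ := exists_eq_sq a20
      have hl : l ≠ 0 := by rintro rfl; simp at h20
      obtain ⟨n, rfl⟩ : ∃ n, a10 = 2 * l * n := ⟨a10 / (2 * l), by field_simp⟩
      obtain ⟨m, rfl⟩ : ∃ m, a11 = 2 * l * m := ⟨a11 / (2 * l), by field_simp⟩
      refine ⟨0, l, m, n, by simp, by simp, rfl, by simp, by simp, rfl, ?_, ?_, ?_⟩ <;>
        apply mul_left_cancel₀ h20
      · linear_combination -p2 / 4
      · linear_combination -q1 / 4
      · linear_combination -q0 / 4
  · obtain ⟨k, rfl⟩ := exists_eq_sq a22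
    have hk : k ≠ 0 := by rintro rfl; simp at h22
    obtain ⟨l, rfl⟩ : ∃ l, a21 = 2 * k * l := ⟨a21 / (2 * k), by field_simp⟩
    obtain ⟨m, rfl⟩ : ∃ m, a12 = 2 * k * m := ⟨a12 / (2 * k), by field_simp⟩
    obtain ⟨n, rfl⟩ : ∃ n, a11 = 2 * k * n + 2 * l * m :=
      ⟨(a11 - 2 * l * m) / (2 * k), by field_simp; ring⟩
    obtain rfl : a20 = l ^ 2 := mul_left_cancel₀ h22 (by linear_combination -p4 / 4)
    obtain rfl : a02 = m ^ 2 := mul_left_cancel₀ h22 (by linear_combination -q4 / 4)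
    obtain rfl : a10 = 2 * l * n := mul_left_cancel₀ h22 (by linear_combination -p3 / 4)
    obtain rfl : a01 = 2 * m * n := mul_left_cancel₀ h22 (by linear_combination -q3 / 4)
    refine ⟨k, l, m, n, rfl, rfl, rfl, rfl, rfl, rfl, rfl, rfl, mul_left_cancel₀ h22 ?_⟩
    linear_combination -p2 / 4

/-- The coefficients of the square of a bilinear polynomial. -/
theorem cf_sq (k l m n : ℂ) (i j : ℕ) (hi : i < 3) (hj : j < 3) :
    cf ((C k * (X 0 * X 1) + C l * X 0 + C m * X 1 + C n) ^ 2) i j =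
      !![n ^ 2, 2 * m * n, m ^ 2;
         2 * l * n, 2 * k * n + 2 * l * m, 2 * k * m;
         l ^ 2, 2 * k * l, k ^ 2] (Fin.ofNat 3 i) (Fin.ofNat 3 j) := by
  rw [← cf_sum_range (fun i j => !![n ^ 2, 2 * m * n, m ^ 2;
         2 * l * n, 2 * k * n + 2 * l * m, 2 * k * m;
         l ^ 2, 2 * k * l, k ^ 2] (Fin.ofNat 3 i) (Fin.ofNat 3 j)) hi hj]
  congr 1
  have h2 : (C 2 : MvPolynomial (Fin 2) ℂ) = 2 := map_ofNat C 2
  simp [h2, Finset.sum_range_succ, Fin.ofNat]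
  ring

theorem ds_sq (k l m n : ℂ) (i : Fin 2) :
    ds i ((C k * (X 0 * X 1) + C l * X 0 + C m * X 1 + C n) ^ 2) = 0 := by
  have h2 : pderiv i (2 : MvPolynomial (Fin 2) ℂ) = 0 := by
    rw [← map_ofNat C 2, pderiv_C]
  fin_cases i <;> simp at h2 <;> simp [h2, ds, pderiv_X, Derivation.leibniz_pow] <;> ring

/-- The discriminant in `y` of a biquadratic polynomial with `δ_y(h) = 0` vanishes. -/
theorem discrim_y_eq_zero {h : MvPolynomial (Fin 2) ℂ} (hh : ∀ i, h.degreeOf i ≤ 2)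
    (hd : ds 1 h = 0) (x : ℂ) :
    (cf h 0 1 + cf h 1 1 * x + cf h 2 1 * x ^ 2) ^ 2 -
      4 * (cf h 0 2 + cf h 1 2 * x + cf h 2 2 * x ^ 2) *
        (cf h 0 0 + cf h 1 0 * x + cf h 2 0 * x ^ 2) = 0 := by
  have hs := eq_sum_range_cf hh
  generalize cf h = a at *
  subst hs
  have := congrArg (eval ![x, 0]) hd
  simp [ds, Finset.sum_range_succ, pderiv_X, Derivation.leibniz_pow] at this
  linear_combination this

/-- The discriminant in `x` of a biquadratic polynomial with `δ_x(h) = 0` vanishes. -/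
theorem discrim_x_eq_zero {h : MvPolynomial (Fin 2) ℂ} (hh : ∀ i, h.degreeOf i ≤ 2)
    (hd : ds 0 h = 0) (y : ℂ) :
    (cf h 1 0 + cf h 1 1 * y + cf h 1 2 * y ^ 2) ^ 2 -
      4 * (cf h 2 0 + cf h 2 1 * y + cf h 2 2 * y ^ 2) *
        (cf h 0 0 + cf h 0 1 * y + cf h 0 2 * y ^ 2) = 0 := by
  have hs := eq_sum_range_cf hh
  generalize cf h = a at *
  subst hs
  have := congrArg (eval ![0, y]) hd
  simp [ds, Finset.sum_range_succ, pderiv_X, Derivation.leibniz_pow] at this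
  linear_combination this

/-- A biquadratic `h(x,y)` satisfies `δ_y(h) = 0`, `δ_x(h) = 0` iff
`h = (κxy + λx + μy + ν)²` for some `κ, λ, μ, ν`; in that case
`i₂(h) = 12(κν - λμ)²` and `i₃(h) = 2(κν - λμ)³`. -/
theorem statement15 (h : MvPolynomial (Fin 2) ℂ) (hh : ∀ i, h.degreeOf i ≤ 2) :
    ((ds 1 h = 0 ∧ ds 0 h = 0) ↔
      ∃ kap lam mu nu : ℂ, h = (C kap * (X 0 * X 1) + C lam * X 0 + C mu * X 1 + C nu) ^ 2) ∧
    (∀ kap lam mu nu : ℂ,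
      h = (C kap * (X 0 * X 1) + C lam * X 0 + C mu * X 1 + C nu) ^ 2 →
        inv2 h = 12 * (kap * nu - lam * mu) ^ 2 ∧
        inv3 h = 2 * (kap * nu - lam * mu) ^ 3) := by
  refine ⟨⟨fun ⟨hy, hx⟩ => ?_, ?_⟩, ?_⟩
  · obtain ⟨k, l, m, n, h22, h21, h20, h12, h11, h10, h02, h01, h00⟩ :=
      exists_sqrt_coeffs (cf h) (discrim_y_eq_zero hh hy) (discrim_x_eq_zero hh hx)
    refine ⟨k, l, m, n, ?_⟩
    rw [eq_sum_range_cf hh]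
    simp only [Finset.sum_range_succ, Finset.sum_range_zero, h22, h21, h20, h12, h11, h10, h02,
      h01, h00, map_add, map_mul, map_pow, map_ofNat]
    ring
  · rintro ⟨k, l, m, n, rfl⟩
    exact ⟨ds_sq k l m n 1, ds_sq k l m n 0⟩
  · rintro k l m n rfl
    constructor
    · simp [inv2, cf_sq, Fin.ofNat]
      ring
    · simp [inv3, cf_sq, Fin.ofNat, Matrix.det_fin_three]
      ring
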